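/- Let 𝔽_4 be a field with 4 elements and α ∈ 𝔽_4 with α² + α + 1 = 0. Then as n → ∞, the real sequence (1/4^n) · #{x ∈ 𝔽_4^n : e_9(x) = β} converges to 45/128 for β = 0, to 29/128 for β = 1, and to 27/128 for each β ∈ {α, α+1}. -/

import Mathlib

open Filter Topology

/-- The elementary symmetric polynomial of degree `k` evaluated at `x ∈ K^n`. -/
def evalE {K : Type*} [CommSemiring K] {n : ℕ} (k : ℕ) (x : Fin n → K) : K :=
  (Multiset.map x Finset.univ.val).esymm k

/-! ### Equidistribution of random walks on finite abelian groups -/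

lemma equidist_point {G K : Type*} [AddCommGroup G] [Fintype G] [DecidableEq G] [Fintype K]
    (s : K → G) (k₀ : K) (hk₀ : s k₀ = 0)
    (hgen : ∀ χ : AddChar G ℂ, (∀ k, χ (s k) = 1) → χ = 0) (g : G) :
    Tendsto (fun n : ℕ => (∑ x : Fin n → K, if ∑ i, s (x i) = g then (1 : ℂ) else 0)
      / (Fintype.card K : ℂ) ^ n) atTop (𝓝 (1 / Fintype.card G)) := by
  classical
  have hq : (0 : ℝ) < Fintype.card K := by
    have : 0 < Fintype.card K := Fintype.card_pos_iff.mpr ⟨k₀⟩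
    exact_mod_cast this
  have hqc : (Fintype.card K : ℂ) ≠ 0 := by exact_mod_cast hq.ne'
  have hG : (Fintype.card G : ℂ) ≠ 0 := by simp
  have key : ∀ n : ℕ, (∑ x : Fin n → K, if ∑ i, s (x i) = g then (1 : ℂ) else 0)
      / (Fintype.card K : ℂ) ^ n = (1 / Fintype.card G) * ∑ χ : AddChar G ℂ,
        χ (-g) * ((∑ k, χ (s k)) / Fintype.card K) ^ n := by
    intro n
    have h1 : ∀ x : Fin n → K, (if ∑ i, s (x i) = g then (1 : ℂ) else 0)
        = (1 / Fintype.card G) * ∑ χ : AddChar G ℂ, χ (-g) * ∏ i, χ (s (x i)) := by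
      intro x
      have h2 : ∀ χ : AddChar G ℂ, χ (-g) * ∏ i, χ (s (x i)) = χ (-g + ∑ i, s (x i)) := by
        intro χ
        rw [AddChar.map_add_eq_mul]
        congr 1
        have : ∀ t : Finset (Fin n), χ (∑ i ∈ t, s (x i)) = ∏ i ∈ t, χ (s (x i)) := by
          intro t
          induction t using Finset.induction_on with
          | empty => simp
          | insert i t hi ih =>
            rw [Finset.sum_insert hi, Finset.prod_insert hi, AddChar.map_add_eq_mul, ih]
        exact (this _).symm
      simp_rw [h2]
      rw [AddChar.sum_apply_eq_ite]
      have : (-g + ∑ i, s (x i) = 0) ↔ ∑ i, s (x i) = g := by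
        rw [neg_add_eq_zero, eq_comm]
      simp only [this]
      split_ifs
      · field_simp
      · simp
    simp_rw [h1]
    rw [← Finset.mul_sum, Finset.sum_comm, mul_div_assoc, Finset.sum_div]
    congr 1
    refine Finset.sum_congr rfl fun χ _ => ?_
    rw [← Finset.mul_sum, mul_div_assoc, div_pow, Finset.sum_pow']
    simp
  simp_rw [key]
  have hlim : Tendsto (fun n : ℕ => (1 / (Fintype.card G : ℂ)) * ∑ χ : AddChar G ℂ,
        χ (-g) * ((∑ k, χ (s k)) / Fintype.card K) ^ n) atTop
      (𝓝 ((1 / (Fintype.card G : ℂ)) * ∑ χ : AddChar G ℂ, if χ = 0 then 1 else 0)) := by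
    refine Tendsto.const_mul _ (tendsto_finsetSum _ fun χ _ => ?_)
    split_ifs with h
    · subst h
      simp [hqc]
    · have : ‖(∑ k, χ (s k)) / (Fintype.card K : ℂ)‖ < 1 := by
        obtain ⟨k₁, hk₁⟩ : ∃ k, χ (s k) ≠ 1 := by
          by_contra! hc
          exact h (hgen χ hc)
        have := norm_sum_lt_of_strictConvexSpace (t := (Finset.univ : Finset K))
          (w := fun _ => (1 : ℝ) / Fintype.card K) (r := 1) (z := fun k => χ (s k))
          (fun _ _ => by positivity) (by simp [hq.ne']) (Finset.mem_univ k₁) (Finset.mem_univ k₀)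
          (by simpa [hk₀] using hk₁) (by simp [hq.ne']) (by simp [hq.ne'])
          (fun k _ => by simp)
        rw [← Finset.smul_sum] at this
        rw [Complex.real_smul] at this
        push_cast at this
        rw [one_div, ← div_eq_inv_mul] at this
        exact this
      simpa using (tendsto_pow_atTop_nhds_zero_of_norm_lt_one this).const_mul (χ (-g))
  simpa using hlim

lemma equidist {G K L : Type*} [AddCommGroup G] [Fintype G] [DecidableEq G] [Fintype K]
    [DecidableEq L]
    (s : K → G) (k₀ : K) (hk₀ : s k₀ = 0)
    (hgen : ∀ χ : AddChar G ℂ, (∀ k, χ (s k) = 1) → χ = 0) (F : G → L) (β : L) :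
    Tendsto (fun n : ℕ =>
      ((Finset.univ.filter (fun x : Fin n → K => F (∑ i, s (x i)) = β)).card : ℝ)
      / (Fintype.card K : ℝ) ^ n) atTop
      (𝓝 ((Finset.univ.filter (fun g => F g = β)).card / Fintype.card G)) := by
  classical
  have h := tendsto_finsetSum (Finset.univ.filter (fun g => F g = β))
    (fun g _ => equidist_point s k₀ hk₀ hgen g)
  have h2 := (Complex.continuous_re.tendsto _).comp h
  convert h2 using 1
  · funext n
    simp only [Function.comp]
    rw [← Finset.sum_div, Finset.sum_comm]
    have : ∀ x : Fin n → K, (∑ g ∈ Finset.univ.filter (fun g => F g = β),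
        if ∑ i, s (x i) = g then (1 : ℂ) else 0) = if F (∑ i, s (x i)) = β then 1 else 0 := by
      intro x
      rw [Finset.sum_ite_eq]
      simp
    simp_rw [this]
    rw [← Finset.sum_filter, Finset.sum_const, nsmul_eq_mul, mul_one]
    rw [← Complex.ofReal_re (_ / _)]
    push_cast
    rfl
  · rw [Finset.sum_const, nsmul_eq_mul]
    congr 1
    rw [← Complex.ofReal_re (_ / _)]
    push_cast
    congr 1
    ring

/-! ### The bit computation -/

def st1 (s : ℕ × ℕ) : ℕ × ℕ := (s.1 ^^^ (s.1 <<< 1), s.2 ^^^ (s.2 <<< 1))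
def st2 (s : ℕ × ℕ) : ℕ × ℕ := (s.1 ^^^ (s.2 <<< 1), s.2 ^^^ ((s.1 ^^^ s.2) <<< 1))
def st3 (s : ℕ × ℕ) : ℕ × ℕ := (s.1 ^^^ ((s.1 ^^^ s.2) <<< 1), s.2 ^^^ (s.1 <<< 1))
def stt (a b c : ℕ) : ℕ × ℕ :=
  Nat.rec (Nat.rec (Nat.rec (1, 0) (fun _ s => st1 s) a) (fun _ s => st2 s) b)
    (fun _ s => st3 s) c
def cls (a b c : ℕ) : ℕ := (stt a b c).1 / 512 % 2 + 2 * ((stt a b c).2 / 512 % 2)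

theorem cnt0 : (∑ a ∈ Finset.range 16, ∑ b ∈ Finset.range 16, ∑ c ∈ Finset.range 16,
   if cls a b c = 0 then 1 else 0) = 1440 := by decide +kernel
theorem cnt1 : (∑ a ∈ Finset.range 16, ∑ b ∈ Finset.range 16, ∑ c ∈ Finset.range 16,
   if cls a b c = 1 then 1 else 0) = 928 := by decide +kernel
theorem cnt2 : (∑ a ∈ Finset.range 16, ∑ b ∈ Finset.range 16, ∑ c ∈ Finset.range 16,
   if cls a b c = 2 then 1 else 0) = 864 := by decide +kernel
theorem cnt3 : (∑ a ∈ Finset.range 16, ∑ b ∈ Finset.range 16, ∑ c ∈ Finset.range 16,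
   if cls a b c = 3 then 1 else 0) = 864 := by decide +kernel

section field
open Polynomial

/-- bit to field -/
def bt (K : Type*) [Field K] (b : Bool) : K := if b then 1 else 0

lemma bt_xor {K : Type*} [Field K] (h2 : (2 : K) = 0) (a b : Bool) :
    bt K (a ^^ b) = bt K a + bt K b := by
  have : (1 : K) + 1 = 0 := by rw [← h2]; norm_num
  cases a <;> cases b <;> simp [bt, this]

/-- The state `s` encodes the polynomial `p`. -/
def Enc {K : Type*} [Field K] (α : K) (s : ℕ × ℕ) (p : K[X]) : Prop :=
  ∀ m, p.coeff m = bt K (s.1.testBit m) + bt K (s.2.testBit m) * α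

noncomputable def tri {K : Type*} [Field K] (α : K) (a b c : ℕ) : K[X] :=
  (1 + C 1 * X) ^ a * (1 + C α * X) ^ b * (1 + C (α + 1) * X) ^ c

lemma coeff_mul_lin_zero {K : Type*} [Field K] (p : K[X]) (r : K) :
    (p * (1 + C r * X)).coeff 0 = p.coeff 0 := by
  simp [mul_add, ← mul_assoc]

lemma coeff_mul_lin_succ {K : Type*} [Field K] (p : K[X]) (r : K) (m : ℕ) :
    (p * (1 + C r * X)).coeff (m + 1) = p.coeff (m + 1) + r * p.coeff m := by
  rw [mul_add, ← mul_assoc, coeff_add, coeff_mul_X, coeff_mul_C, mul_one, mul_comm r]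

lemma enc1 {K : Type*} [Field K] (h2 : (2 : K) = 0) (α : K) (s : ℕ × ℕ)
    (p : K[X]) (h : Enc α s p) : Enc α (st1 s) (p * (1 + C 1 * X)) := by
  intro m
  cases m with
  | zero => rw [coeff_mul_lin_zero, h 0]; simp only [st1, Nat.testBit_xor, Nat.testBit_shiftLeft]; simp
  | succ m =>
    rw [coeff_mul_lin_succ, h m, h (m + 1)]
    simp [st1, Nat.testBit_shiftLeft, bt_xor h2]
    ring

lemma enc2 {K : Type*} [Field K] (h2 : (2 : K) = 0) (α : K) (hα : α ^ 2 + α + 1 = 0) (s : ℕ × ℕ)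
    (p : K[X]) (h : Enc α s p) : Enc α (st2 s) (p * (1 + C α * X)) := by
  intro m
  cases m with
  | zero => rw [coeff_mul_lin_zero, h 0]; simp only [st2, Nat.testBit_xor, Nat.testBit_shiftLeft]; simp
  | succ m =>
    rw [coeff_mul_lin_succ, h m, h (m + 1)]
    simp [st2, Nat.testBit_shiftLeft, bt_xor h2]
    linear_combination bt K (s.2.testBit m) * hα - bt K (s.2.testBit m) * (α + 1) * h2

lemma enc3 {K : Type*} [Field K] (h2 : (2 : K) = 0) (α : K) (hα : α ^ 2 + α + 1 = 0) (s : ℕ × ℕ)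
    (p : K[X]) (h : Enc α s p) : Enc α (st3 s) (p * (1 + C (α + 1) * X)) := by
  intro m
  cases m with
  | zero => rw [coeff_mul_lin_zero, h 0]; simp only [st3, Nat.testBit_xor, Nat.testBit_shiftLeft]; simp
  | succ m =>
    rw [coeff_mul_lin_succ, h m, h (m + 1)]
    simp [st3, Nat.testBit_shiftLeft, bt_xor h2]
    linear_combination bt K (s.2.testBit m) * hα - bt K (s.2.testBit m) * h2

lemma enc_tri {K : Type*} [Field K] (h2 : (2 : K) = 0) (α : K) (hα : α ^ 2 + α + 1 = 0)
    (a b c : ℕ) : Enc α (stt a b c) (tri α a b c) := by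
  induction c with
  | zero =>
    induction b with
    | zero =>
      induction a with
      | zero =>
        intro m
        rcases m with _ | m
        · simp [tri, stt, bt]
        · simp [tri, stt, bt, coeff_one, Nat.testBit_succ]
      | succ a ih =>
        have := enc1 h2 α _ _ ih
        have e : tri α (a + 1) 0 0 = tri α a 0 0 * (1 + C 1 * X) := by
          unfold tri; ring
        rw [e]; exact this
    | succ b ih =>
      have := enc2 h2 α hα _ _ ih
      have e : tri α a (b + 1) 0 = tri α a b 0 * (1 + C α * X) := by
        unfold tri; ring
      rw [e]; exact this
  | succ c ih =>
    have := enc3 h2 α hα _ _ ih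
    have e : tri α a b (c + 1) = tri α a b c * (1 + C (α + 1) * X) := by
      unfold tri; ring
    rw [e]; exact this

/-- The field element with a given class. -/
def val4 {K : Type*} [Field K] (α : K) : ℕ → K
  | 0 => 0
  | 1 => 1
  | 2 => α
  | _ => α + 1

lemma coeff_tri {K : Type*} [Field K] (h2 : (2 : K) = 0) (α : K) (hα : α ^ 2 + α + 1 = 0)
    (a b c : ℕ) : (tri α a b c).coeff 9 = val4 α (cls a b c) ∧ cls a b c < 4 := by
  rw [enc_tri h2 α hα a b c 9]
  simp only [Nat.testBit_eq_decide_div_mod_eq, cls]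
  norm_num
  rcases Nat.mod_two_eq_zero_or_one ((stt a b c).1 / 512) with h | h <;>
  rcases Nat.mod_two_eq_zero_or_one ((stt a b c).2 / 512) with h' | h' <;>
  simp [h, h', bt, val4, add_comm]

lemma lin_pow_16 {K : Type*} [Field K] (h2 : (2 : K) = 0) (r : K) :
    (1 + C r * X : K[X]) ^ 16 = 1 + C (r ^ 16) * X ^ 16 := by
  have : CharP K 2 := CharTwo.of_one_ne_zero_of_two_eq_zero one_ne_zero h2
  have := add_pow_char_pow (R := K[X]) (p := 2) (n := 4) 1 (C r * X)
  norm_num at this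
  rw [this, mul_pow, C_pow]

lemma coeff_mul_pow_16 {K : Type*} [Field K] (h2 : (2 : K) = 0) (p : K[X]) (r : K) (k : ℕ) :
    (p * ((1 + C r * X) ^ 16) ^ k).coeff 9 = p.coeff 9 := by
  induction k with
  | zero => simp
  | succ k ih =>
    rw [pow_succ, ← mul_assoc, lin_pow_16 h2, mul_add, mul_one, coeff_add, ← mul_assoc,
      coeff_mul_X_pow', ← lin_pow_16 h2, ih]
    simp

lemma tri_mod {K : Type*} [Field K] (h2 : (2 : K) = 0) (α : K) (a b c : ℕ) :
    (tri α (a % 16) (b % 16) (c % 16)).coeff 9 = (tri α a b c).coeff 9 := by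
  have e : tri α a b c = tri α (a % 16) (b % 16) (c % 16) * ((1 + C 1 * X) ^ 16) ^ (a / 16)
      * ((1 + C α * X) ^ 16) ^ (b / 16) * ((1 + C (α + 1) * X) ^ 16) ^ (c / 16) := by
    unfold tri
    conv_lhs => rw [← Nat.mod_add_div a 16, ← Nat.mod_add_div b 16, ← Nat.mod_add_div c 16]
    rw [pow_add, pow_add, pow_add, pow_mul, pow_mul, pow_mul]
    ring
  rw [e, coeff_mul_pow_16 h2, coeff_mul_pow_16 h2, coeff_mul_pow_16 h2]

lemma coeff_esymm {K : Type*} [Field K] (s : Multiset K) (k : ℕ) :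
    ((s.map fun r => 1 + C r * X).prod).coeff k = s.esymm k := by
  induction s using Multiset.induction generalizing k with
  | empty =>
    cases k with
    | zero => simp [Multiset.esymm]
    | succ k => simp [Multiset.esymm, coeff_one, Multiset.powersetCard_zero_right]
  | cons a s ih =>
    rw [Multiset.map_cons, Multiset.prod_cons, mul_comm]
    cases k with
    | zero => rw [coeff_mul_lin_zero, ih]; simp [Multiset.esymm]
    | succ k =>
      rw [coeff_mul_lin_succ, ih, ih]
      simp [Multiset.esymm, Multiset.powersetCard_cons, Multiset.sum_map_mul_left]

abbrev GG := ZMod 16 × ZMod 16 × ZMod 16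

def stepG {K : Type*} [Field K] [DecidableEq K] (α : K) (k : K) : GG :=
  if k = 0 then 0 else if k = 1 then (1, 0, 0) else if k = α then (0, 1, 0) else (0, 0, 1)

noncomputable def FG {K : Type*} [Field K] (α : K) (g : GG) : K :=
  (tri α g.1.val g.2.1.val g.2.2.val).coeff 9

lemma FG_sum {K : Type*} [Field K] [DecidableEq K] (h2 : (2 : K) = 0) (α : K)
    (hα0 : α ≠ 0) (hα1 : α ≠ 1) (hall : ∀ k : K, k = 0 ∨ k = 1 ∨ k = α ∨ k = α + 1)
    (s : Multiset K) : FG α (s.map (stepG α)).sum = s.esymm 9 := by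
  have key : ∃ a b c : ℕ, (s.map fun r => 1 + C r * X).prod = tri α a b c ∧
      (s.map (stepG α)).sum = ((a : ZMod 16), (b : ZMod 16), (c : ZMod 16)) := by
    induction s using Multiset.induction with
    | empty => exact ⟨0, 0, 0, by simp [tri], by simp; rfl⟩
    | cons k s ih =>
      obtain ⟨a, b, c, h, h'⟩ := ih
      rw [Multiset.map_cons, Multiset.prod_cons, Multiset.map_cons, Multiset.sum_cons, h, h']
      have h10 : α + 1 ≠ 0 := fun h0 => hα1 (by linear_combination h0 - h2)
      have h11 : α + 1 ≠ 1 := fun h0 => hα0 (by linear_combination h0)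
      rcases hall k with rfl | rfl | rfl | rfl
      · exact ⟨a, b, c, by simp, by simp [stepG]⟩
      · exact ⟨a + 1, b, c, by unfold tri; ring, by simp [stepG, add_comm]⟩
      · exact ⟨a, b + 1, c, by unfold tri; ring, by simp [stepG, add_comm, hα0, hα1]⟩
      · exact ⟨a, b, c + 1, by unfold tri; ring, by simp [stepG, add_comm (c : ZMod 16), h10, h11]⟩
  obtain ⟨a, b, c, h, h'⟩ := key
  rw [← coeff_esymm, h, h', FG]
  simp only [ZMod.val_natCast]
  exact tri_mod h2 α a b c

lemma card_FG {K : Type*} [Field K] [DecidableEq K] (h2 : (2 : K) = 0) (α : K)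
    (hα : α ^ 2 + α + 1 = 0)
    (hα0 : α ≠ 0) (hα1 : α ≠ 1) (j : ℕ) (hj : j < 4) :
    (Finset.univ.filter (fun g : GG => FG α g = val4 α j)).card =
    (∑ a ∈ Finset.range 16, ∑ b ∈ Finset.range 16, ∑ c ∈ Finset.range 16,
      if cls a b c = j then 1 else 0) := by
  have h10 : α + 1 ≠ 0 := fun h0 => hα1 (by linear_combination h0 - h2)
  have hinj : ∀ i < 4, (val4 α i = val4 α j ↔ i = j) := by
    intro i hi
    interval_cases i <;> interval_cases j <;>
      simp [val4, hα0, hα1, h10, hα0.symm, hα1.symm, h10.symm]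
  have hFG : ∀ g : GG, FG α g = val4 α j ↔ cls g.1.val g.2.1.val g.2.2.val = j := by
    intro g
    obtain ⟨h, h'⟩ := coeff_tri h2 α hα g.1.val g.2.1.val g.2.2.val
    rw [FG, h, hinj _ h']
  simp_rw [hFG]
  rw [Finset.card_filter, Fintype.sum_prod_type]
  simp_rw [Fintype.sum_prod_type]
  rw [← Fin.sum_univ_eq_sum_range (fun a => ∑ b ∈ Finset.range 16, ∑ c ∈ Finset.range 16,
      if cls a b c = j then 1 else 0)]
  simp_rw [← Fin.sum_univ_eq_sum_range]
  rfl

lemma stepG_gen {K : Type*} [Field K] [DecidableEq K] (h2 : (2 : K) = 0) (α : K)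
    (hα0 : α ≠ 0) (hα1 : α ≠ 1)
    (χ : AddChar GG ℂ) (h : ∀ k, χ (stepG α k) = 1) : χ = 0 := by
  have h10 : α + 1 ≠ 0 := fun h0 => hα1 (by linear_combination h0 - h2)
  have h11 : α + 1 ≠ 1 := fun h0 => hα0 (by linear_combination h0)
  have e1 : χ (1, 0, 0) = 1 := by simpa [stepG] using h 1
  have e2 : χ (0, 1, 0) = 1 := by simpa [stepG, hα0, hα1] using h α
  have e3 : χ (0, 0, 1) = 1 := by simpa [stepG, h10, h11] using h (α + 1)
  ext ⟨a, b, c⟩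
  have : ((a, b, c) : GG) = a.val • ((1, 0, 0) : GG) + b.val • ((0, 1, 0) : GG)
      + c.val • ((0, 0, 1) : GG) := by
    simp
  rw [this, AddChar.map_add_eq_mul, AddChar.map_add_eq_mul, AddChar.map_nsmul_eq_pow,
    AddChar.map_nsmul_eq_pow, AddChar.map_nsmul_eq_pow, e1, e2, e3]
  simp

lemma main_aux {K : Type*} [Field K] [Fintype K] [DecidableEq K]
    (hK : Fintype.card K = 4) (α : K) (hα : α ^ 2 + α + 1 = 0) (j : ℕ) (hj : j < 4) :
    Tendsto (fun n : ℕ =>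
        ((Finset.univ.filter (fun x : Fin n → K => evalE 9 x = val4 α j)).card : ℝ)
          / (4 : ℝ) ^ n) atTop
      (𝓝 (((∑ a ∈ Finset.range 16, ∑ b ∈ Finset.range 16, ∑ c ∈ Finset.range 16,
      if cls a b c = j then 1 else 0 : ℕ) : ℝ) / 4096)) := by
  have h2 : (2 : K) = 0 := by
    have h4 : ((Fintype.card K : ℕ) : K) = 0 := Nat.cast_card_eq_zero K
    rw [hK] at h4
    have : (2 : K) * 2 = 0 := by rw [← h4]; norm_num
    simpa using this
  have hα0 : α ≠ 0 := by
    rintro rfl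
    simp at hα
  have hα1 : α ≠ 1 := by
    rintro rfl
    exact one_ne_zero (α := K) (by linear_combination hα - h2)
  have h10 : α + 1 ≠ 0 := fun h0 => hα1 (by linear_combination h0 - h2)
  have hall : ∀ k : K, k = 0 ∨ k = 1 ∨ k = α ∨ k = α + 1 := by
    have hu : ({0, 1, α, α + 1} : Finset K) = Finset.univ := by
      apply Finset.eq_univ_of_card
      rw [hK]
      rw [Finset.card_insert_of_notMem, Finset.card_insert_of_notMem,
        Finset.card_insert_of_notMem, Finset.card_singleton] <;>
      simp [hα0, hα1.symm, hα0.symm, h10.symm]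
    intro k
    have := Finset.mem_univ k
    rw [← hu] at this
    simpa using this
  have h := equidist (stepG α) 0 (by simp [stepG]) (stepG_gen h2 α hα0 hα1) (FG α) (val4 α j)
  rw [card_FG h2 α hα hα0 hα1 j hj] at h
  have hs : ∀ (n : ℕ) (x : Fin n → K), FG α (∑ i, stepG α (x i)) = evalE 9 x := by
    intro n x
    rw [evalE, ← FG_sum h2 α hα0 hα1 hall, Multiset.map_map]
    rfl
  simp only [hs, hK] at h
  have hc : (Fintype.card GG : ℝ) = 4096 := by
    simp [GG, ZMod.card]
  rw [hc] at h
  exact_mod_cast h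

end field

/-- **Example 3.7.** Over `𝔽_4 = 𝔽_2(α)` with `α² + α + 1 = 0`, the limiting
value distribution of `e_9` is `45/128` at `0`, `29/128` at `1`, and `27/128` at each of
`α`, `α + 1`. -/
theorem limit_distribution_F4_e9 (K : Type*) [Field K] [Fintype K] [DecidableEq K]
    (hK : Fintype.card K = 4) (α : K) (hα : α ^ 2 + α + 1 = 0) :
    Tendsto (fun n : ℕ =>
        ((Finset.univ.filter (fun x : Fin n → K => evalE 9 x = 0)).card : ℝ) / (4 : ℝ) ^ n)
      atTop (𝓝 (45 / 128)) ∧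
    Tendsto (fun n : ℕ =>
        ((Finset.univ.filter (fun x : Fin n → K => evalE 9 x = 1)).card : ℝ) / (4 : ℝ) ^ n)
      atTop (𝓝 (29 / 128)) ∧
    Tendsto (fun n : ℕ =>
        ((Finset.univ.filter (fun x : Fin n → K => evalE 9 x = α)).card : ℝ) / (4 : ℝ) ^ n)
      atTop (𝓝 (27 / 128)) ∧
    Tendsto (fun n : ℕ =>
        ((Finset.univ.filter (fun x : Fin n → K => evalE 9 x = α + 1)).card : ℝ) / (4 : ℝ) ^ n)
      atTop (𝓝 (27 / 128)) := by
  have h0 := main_aux hK α hα 0 (by norm_num)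
  have h1 := main_aux hK α hα 1 (by norm_num)
  have h2 := main_aux hK α hα 2 (by norm_num)
  have h3 := main_aux hK α hα 3 (by norm_num)
  rw [cnt0, show ((1440 : ℕ) : ℝ) / 4096 = 45 / 128 by norm_num] at h0
  rw [cnt1, show ((928 : ℕ) : ℝ) / 4096 = 29 / 128 by norm_num] at h1
  rw [cnt2, show ((864 : ℕ) : ℝ) / 4096 = 27 / 128 by norm_num] at h2
  rw [cnt3, show ((864 : ℕ) : ℝ) / 4096 = 27 / 128 by norm_num] at h3
  simp only [val4] at h0 h1 h2 h3
  exact ⟨h0, h1, h2, h3⟩
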